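/- Let n ≥ 1. Let L be the n×n matrix over ℚ with L_{ij} = 1 if i ≥ j and L_{ij} = 0 otherwise (lower triangular with 1's on and below the diagonal), and let M be the n×n matrix over ℚ whose j-th column is -e_n for j = 1 and e_{j-1} - e_n for 2 ≤ j ≤ n (where e_1,…,e_n is the standard basis), i.e. M_{ij} = [i = j-1] - [i = n]. Then M = -(Lᵀ)⁻¹ · L. -/

import Mathlib

/-- The matrix `M` of the cyclic structure map `τ_n` of the anticyclic diassociative
operad in the basis `e^n_m` equals `-(Lᵀ)⁻¹ * L`, where `L` is the lower triangular
matrix with `1`'s on and below the diagonal.  (Indices are `0`-based: the basis vector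
`e^n_m`, `1 ≤ m ≤ n`, corresponds to `m - 1 : Fin n`.) -/
theorem stmt_0 (n : ℕ) (hn : 1 ≤ n) (L M : Matrix (Fin n) (Fin n) ℚ)
    (hL : ∀ i j : Fin n, L i j = if j ≤ i then 1 else 0)
    (hM : ∀ i j : Fin n, M i j =
      (if (i : ℕ) + 1 = (j : ℕ) then 1 else 0) - (if (i : ℕ) = n - 1 then 1 else 0)) :
    M = -(L.transpose)⁻¹ * L := by
  have hdet : IsUnit L.transpose.det := by
    rw [Matrix.det_transpose, Matrix.det_of_isLowerTriangular L]
    · simp [hL]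
    · intro i j hij
      have hij : i < j := hij
      simp [hL, hij]
  have hmul : L.transpose * M = -L := by
    ext i j
    have hlast : ∑ k : Fin n, (if i ≤ k then (1 : ℚ) else 0) *
        (if (k : ℕ) = n - 1 then 1 else 0) = 1 := by
      rw [Finset.sum_eq_single (⟨n - 1, by omega⟩ : Fin n)]
      · have : i ≤ (⟨n - 1, by omega⟩ : Fin n) := by
          rw [Fin.le_def]; dsimp only; omega
        simp [this]
      · intro k _ hk
        have : (k : ℕ) ≠ n - 1 := fun h => hk (Fin.ext h)
        simp [this]
      · simp
    have hshift : ∑ k : Fin n, (if i ≤ k then (1 : ℚ) else 0) *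
        (if (k : ℕ) + 1 = (j : ℕ) then 1 else 0) = if i < j then 1 else 0 := by
      by_cases hij : i < j
      · have hij' : (i : ℕ) < j := hij
        rw [Finset.sum_eq_single (⟨(j : ℕ) - 1, by omega⟩ : Fin n)]
        · have h₁ : i ≤ (⟨(j : ℕ) - 1, by omega⟩ : Fin n) := by
            rw [Fin.le_def]; dsimp only; omega
          have h₂ : (j : ℕ) - 1 + 1 = j := by omega
          simp [h₁, h₂, hij]
        · intro k _ hk
          have : (k : ℕ) + 1 ≠ j := fun h => hk (Fin.ext (by dsimp only; omega))
          simp [this]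
        · simp
      · rw [if_neg hij]
        refine Finset.sum_eq_zero fun k _ => ?_
        by_cases hk : i ≤ k
        · have : (k : ℕ) + 1 ≠ j := by
            simp only [Fin.le_def, Fin.lt_def] at hk hij; omega
          rw [if_neg this, mul_zero]
        · simp [hk]
    simp only [Matrix.mul_apply, Matrix.transpose_apply, Matrix.neg_apply, hL, hM, mul_sub,
      Finset.sum_sub_distrib, hlast, hshift]
    by_cases hij : i < j
    · simp [hij]
    · simp [hij, not_lt.mp hij]
  rw [Matrix.neg_mul, ← Matrix.mul_neg, ← hmul, Matrix.nonsing_inv_mul_cancel_left _ _ hdet]
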